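/- Let f be a definable real-valued function with definable domain D ⊆ ℝ, and let D' = {t ∈ ℝ : f is defined on a neighborhood of t and differentiable at t}. Then: the derivative f' is a definable function on D' (its graph {(t,α) : t ∈ D', α = f'(t)} is definable); (a) D' is an open subset of ℝ; (b) f' is continuous on D'; (c) the set D \ D' is finite. -/

import Mathlib

open Filter Metric Set Topology FirstOrder
open scoped ENNReal NNReal

noncomputable section

/-- The modulus of surjection `Sur F(x,y)(λ)`: the supremum of the radii `r ∈ [0,∞]`
such that the closed ball of radius `r` around `y` is contained in the image under `F`
of the closed ball of radius `lam` around `x` (with `sup ∅ = 0`). -/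
def surMod {X Y : Type*} [PseudoMetricSpace X] [PseudoMetricSpace Y]
    (F : X → Set Y) (x : X) (y : Y) (lam : ℝ) : ℝ≥0∞ :=
  sSup {r : ℝ≥0∞ | {v : Y | edist v y ≤ r} ⊆ ⋃ u ∈ Metric.closedBall x lam, F u}

/-- The rate of surjection `sur F(x̄|ȳ) = liminf_{(x,y,λ)→(x̄,ȳ,0+)} Sur F(x,y)(λ)/λ`. -/
def surRate {X Y : Type*} [PseudoMetricSpace X] [PseudoMetricSpace Y]
    (F : X → Set Y) (xb : X) (yb : Y) : ℝ≥0∞ :=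
  Filter.liminf
    (fun p : (X × Y) × ℝ => surMod F p.1.1 p.1.2 p.2 / ENNReal.ofReal p.2)
    ((𝓝 (xb, yb)) ×ˢ (𝓝[>] (0 : ℝ)))

/-- The graph of a set-valued mapping. -/
def svGraph {X Y : Type*} (F : X → Set Y) : Set (X × Y) := {p | p.2 ∈ F p.1}

/-- `y` is a critical value of `F` : there is `x` with `y ∈ F(x)` and `sur F(x|y) = 0`. -/
def IsCriticalValue {X Y : Type*} [PseudoMetricSpace X] [PseudoMetricSpace Y]
    (F : X → Set Y) (y : Y) : Prop :=
  ∃ x, y ∈ F x ∧ surRate F x y = 0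

/-- Definability (with parameters from `ℝ`) of a set of tuples. -/
def DefinableT (L : FirstOrder.Language) [L.Structure ℝ] {α : Type}
    (s : Set (α → ℝ)) : Prop :=
  (Set.univ : Set ℝ).Definable L s

/-- The o-minimality hypotheses: the order, addition and multiplication are definable and
every definable subset of `ℝ` is a finite union of points and open intervals. -/
structure IsOMinimalOn (L : FirstOrder.Language) [L.Structure ℝ] : Prop where
  definable_lt : DefinableT L {v : Fin 2 → ℝ | v 0 < v 1}
  definable_add : DefinableT L {v : Fin 3 → ℝ | v 2 = v 0 + v 1}
  definable_mul : DefinableT L {v : Fin 3 → ℝ | v 2 = v 0 * v 1}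
  finite_union : ∀ s : Set ℝ, DefinableT L {v : Fin 1 → ℝ | v 0 ∈ s} →
    ∃ (P : Finset ℝ) (I : Finset (EReal × EReal)),
      s = ↑P ∪ ⋃ p ∈ (I : Set (EReal × EReal)), {x : ℝ | p.1 < (x : EReal) ∧ (x : EReal) < p.2}

/-- Coding of a subset of `ℝⁿ × ℝᵐ` as a set of tuples. -/
def codeProd {n m : ℕ} (S : Set (EuclideanSpace ℝ (Fin n) × EuclideanSpace ℝ (Fin m))) :
    Set (Fin n ⊕ Fin m → ℝ) :=
  {v | ((WithLp.equiv 2 (Fin n → ℝ)).symm fun i => v (Sum.inl i),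
        (WithLp.equiv 2 (Fin m → ℝ)).symm fun j => v (Sum.inr j)) ∈ S}

/-- Coding of a subset of `ℝᵐ` as a set of tuples. -/
def codeE {m : ℕ} (S : Set (EuclideanSpace ℝ (Fin m))) : Set (Fin m → ℝ) :=
  {v | (WithLp.equiv 2 (Fin m → ℝ)).symm v ∈ S}

/-- A set of tuples is tame if its intersection with every bounded definable set is
definable. -/
def TameT (L : FirstOrder.Language) [L.Structure ℝ] {α : Type} [Fintype α]
    (s : Set (α → ℝ)) : Prop :=
  ∀ b : Set (α → ℝ), DefinableT L b → Bornology.IsBounded b → DefinableT L (s ∩ b)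

/-- A porous set in a metric space. -/
def Porous {X : Type*} [PseudoMetricSpace X] (Q : Set X) : Prop :=
  ∃ lam > (0 : ℝ), ∀ x ∈ Q, ∀ r > (0 : ℝ),
    ∃ z, Metric.ball z (lam * r) ⊆ Metric.ball x r \ Q

/-- A σ-porous set: a countable union of porous sets. -/
def SigmaPorous {X : Type*} [PseudoMetricSpace X] (Q : Set X) : Prop :=
  ∃ f : ℕ → Set X, (∀ i, Porous (f i)) ∧ Q = ⋃ i, f i

section Calculus

variable {L : FirstOrder.Language} [L.Structure ℝ] {α : Type}

/-- Definability (with parameters from `ℝ`) of a real-valued function of tuples. -/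
abbrev DefinableFunT (L : FirstOrder.Language) [L.Structure ℝ] {α : Type}
    (F : (α → ℝ) → ℝ) : Prop :=
  (Set.univ : Set ℝ).DefinableFun L F

theorem DefinableT.and {P Q : (α → ℝ) → Prop} (hP : DefinableT L {v | P v})
    (hQ : DefinableT L {v | Q v}) : DefinableT L {v | P v ∧ Q v} :=
  Set.Definable.inter hP hQ

theorem DefinableT.or {P Q : (α → ℝ) → Prop} (hP : DefinableT L {v | P v})
    (hQ : DefinableT L {v | Q v}) : DefinableT L {v | P v ∨ Q v} :=
  Set.Definable.union hP hQ

theorem DefinableT.not {P : (α → ℝ) → Prop} (hP : DefinableT L {v | P v}) :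
    DefinableT L {v | ¬ P v} :=
  Set.Definable.compl hP

theorem DefinableT.imp {P Q : (α → ℝ) → Prop} (hP : DefinableT L {v | P v})
    (hQ : DefinableT L {v | Q v}) : DefinableT L {v | P v → Q v} := by
  simpa only [imp_iff_not_or] using hP.not.or hQ

theorem DefinableT.exists {P : (α → ℝ) → ℝ → Prop}
    (hP : DefinableT L {w : Option α → ℝ | P (fun i => w (some i)) (w none)}) :
    DefinableT L {v | ∃ x, P v x} := by
  have h := (hP.preimage_comp fun o : Option α =>
    o.elim (Sum.inr ()) (Sum.inl : α → α ⊕ Unit)).exists_of_finite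
  refine (congr_arg (DefinableT L) (Set.ext fun v => ?_)).mp h
  exact ⟨fun ⟨u, hu⟩ => ⟨u (), hu⟩, fun ⟨x, hx⟩ => ⟨fun _ => x, hx⟩⟩

theorem DefinableT.forall {P : (α → ℝ) → ℝ → Prop}
    (hP : DefinableT L {w : Option α → ℝ | P (fun i => w (some i)) (w none)}) :
    DefinableT L {v | ∀ x, P v x} := by
  simpa only [not_exists, not_not] using (DefinableT.exists (P := fun v x => ¬ P v x) hP.not).not

theorem definableFunT_var (i : α) : DefinableFunT L (fun v => v i) :=
  Set.DefinableFun.proj L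

theorem definableFunT_const (c : ℝ) : DefinableFunT L (fun _ : α → ℝ => c) :=
  L.definableFun_const α (mem_univ c)

theorem DefinableFunT.weaken {F : (α → ℝ) → ℝ} (hF : DefinableFunT L F) :
    DefinableFunT L (fun w : Option α → ℝ => F (fun i => w (some i))) :=
  hF.preimage_comp fun o : Option α => o.elim none (fun i => some (some i))

theorem DefinableFunT.eq {F G : (α → ℝ) → ℝ} (hF : DefinableFunT L F) (hG : DefinableFunT L G) :
    DefinableT L {v | F v = G v} :=
  hF.ofPred_eq hG

theorem DefinableT.comp₁ {P : ℝ → Prop} (hP : DefinableT L {v : Fin 1 → ℝ | P (v 0)})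
    {F : (α → ℝ) → ℝ} (hF : DefinableFunT L F) : DefinableT L {v | P (F v)} :=
  Set.Definable.preimage_map (F := fun v => ![F v])
    (by intro i; fin_cases i; exact hF) hP

theorem DefinableT.comp₂ {P : ℝ → ℝ → Prop} (hP : DefinableT L {v : Fin 2 → ℝ | P (v 0) (v 1)})
    {F G : (α → ℝ) → ℝ} (hF : DefinableFunT L F) (hG : DefinableFunT L G) :
    DefinableT L {v | P (F v) (G v)} :=
  Set.Definable.preimage_map (F := fun v => ![F v, G v])
    (by intro i; fin_cases i; exacts [hF, hG]) hP

theorem DefinableT.comp₃ {P : ℝ → ℝ → ℝ → Prop}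
    (hP : DefinableT L {v : Fin 3 → ℝ | P (v 0) (v 1) (v 2)})
    {F G H : (α → ℝ) → ℝ} (hF : DefinableFunT L F) (hG : DefinableFunT L G)
    (hH : DefinableFunT L H) : DefinableT L {v | P (F v) (G v) (H v)} :=
  Set.Definable.preimage_map (F := fun v => ![F v, G v, H v])
    (by intro i; fin_cases i; exacts [hF, hG, hH]) hP

theorem DefinableFunT.apply {g : ℝ → ℝ} (hg : DefinableT L {v : Fin 2 → ℝ | v 1 = g (v 0)})
    {F : (α → ℝ) → ℝ} (hF : DefinableFunT L F) : DefinableFunT L (fun v => g (F v)) :=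
  (congr_arg (DefinableT L) (Set.ext fun _ => eq_comm)).mp <|
    DefinableT.comp₂ (P := fun x y => y = g x) hg hF.weaken (definableFunT_var none)

theorem IsOMinimalOn.lt (hL : IsOMinimalOn L) {F G : (α → ℝ) → ℝ}
    (hF : DefinableFunT L F) (hG : DefinableFunT L G) :
    DefinableT L {v | F v < G v} :=
  DefinableT.comp₂ hL.definable_lt hF hG

theorem IsOMinimalOn.le (hL : IsOMinimalOn L) {F G : (α → ℝ) → ℝ}
    (hF : DefinableFunT L F) (hG : DefinableFunT L G) :
    DefinableT L {v | F v ≤ G v} := by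
  simpa only [not_lt] using (hL.lt hG hF).not

theorem IsOMinimalOn.add (hL : IsOMinimalOn L) {F G : (α → ℝ) → ℝ}
    (hF : DefinableFunT L F) (hG : DefinableFunT L G) :
    DefinableFunT L (fun v => F v + G v) :=
  (congr_arg (DefinableT L) (Set.ext fun _ => eq_comm)).mp <|
    DefinableT.comp₃ (P := fun x y z => z = x + y) hL.definable_add hF.weaken hG.weaken
      (definableFunT_var none)

theorem IsOMinimalOn.mul (hL : IsOMinimalOn L) {F G : (α → ℝ) → ℝ}
    (hF : DefinableFunT L F) (hG : DefinableFunT L G) :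
    DefinableFunT L (fun v => F v * G v) :=
  (congr_arg (DefinableT L) (Set.ext fun _ => eq_comm)).mp <|
    DefinableT.comp₃ (P := fun x y z => z = x * y) hL.definable_mul hF.weaken hG.weaken
      (definableFunT_var none)

theorem IsOMinimalOn.neg (hL : IsOMinimalOn L) {F : (α → ℝ) → ℝ} (hF : DefinableFunT L F) :
    DefinableFunT L (fun v => -F v) := by
  simpa only [neg_one_mul] using hL.mul (definableFunT_const (-1)) hF

theorem IsOMinimalOn.sub (hL : IsOMinimalOn L) {F G : (α → ℝ) → ℝ}
    (hF : DefinableFunT L F) (hG : DefinableFunT L G) :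
    DefinableFunT L (fun v => F v - G v) := by
  simpa only [sub_eq_add_neg] using hL.add hF (hL.neg hG)

theorem IsOMinimalOn.abs (hL : IsOMinimalOn L) {F : (α → ℝ) → ℝ} (hF : DefinableFunT L F) :
    DefinableFunT L (fun v => |F v|) := by
  classical
  have h := DefinableFun.ite (hL.le (definableFunT_const 0) hF) hF (hL.neg hF)
  refine (congr_arg (DefinableFunT L) (funext fun v => ?_)).mp h
  split_ifs with h0
  · exact (abs_of_nonneg h0).symm
  · exact (abs_of_neg (not_le.mp h0)).symm

theorem IsOMinimalOn.eventually_nhds (hL : IsOMinimalOn L) {P : (α → ℝ) → ℝ → Prop}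
    {T : (α → ℝ) → ℝ} (hT : DefinableFunT L T)
    (hP : DefinableT L {w : Option α → ℝ | P (fun i => w (some i)) (w none)}) :
    DefinableT L {v | ∀ᶠ x in 𝓝 (T v), P v x} := by
  have h := DefinableT.exists (P := fun v a => a < T v ∧ ∃ b, T v < b ∧
      ∀ x, a < x → x < b → P v x) <|
    (hL.lt (definableFunT_var none) hT.weaken).and <| DefinableT.exists <|
    (hL.lt hT.weaken.weaken (definableFunT_var none)).and <| DefinableT.forall <|
    (hL.lt (definableFunT_var (some (some none))) (definableFunT_var none)).imp <|
    (hL.lt (definableFunT_var none) (definableFunT_var (some none))).imp <|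
    hP.preimage_comp fun o : Option α => o.elim none fun i => some (some (some i))
  refine (congr_arg (DefinableT L) (Set.ext fun v => ?_)).mp h
  refine Iff.trans ?_ mem_nhds_iff_exists_Ioo_subset.symm
  exact ⟨fun ⟨a, ha, b, hb, h⟩ => ⟨a, b, ⟨ha, hb⟩, fun x hx => h x hx.1 hx.2⟩,
    fun ⟨a, b, hab, h⟩ => ⟨a, hab.1, b, hab.2, fun x h1 h2 => h ⟨h1, h2⟩⟩⟩

theorem IsOMinimalOn.eventually_nhdsGT (hL : IsOMinimalOn L) {P : (α → ℝ) → ℝ → Prop}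
    {T : (α → ℝ) → ℝ} (hT : DefinableFunT L T)
    (hP : DefinableT L {w : Option α → ℝ | P (fun i => w (some i)) (w none)}) :
    DefinableT L {v | ∀ᶠ x in 𝓝[>] (T v), P v x} := by
  simp only [eventually_nhdsWithin_iff, mem_Ioi]
  exact hL.eventually_nhds (P := fun v x => T v < x → P v x) hT <|
    (hL.lt hT.weaken (definableFunT_var none)).imp hP

theorem IsOMinimalOn.eventually_nhdsLT (hL : IsOMinimalOn L) {P : (α → ℝ) → ℝ → Prop}
    {T : (α → ℝ) → ℝ} (hT : DefinableFunT L T)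
    (hP : DefinableT L {w : Option α → ℝ | P (fun i => w (some i)) (w none)}) :
    DefinableT L {v | ∀ᶠ x in 𝓝[<] (T v), P v x} := by
  simp only [eventually_nhdsWithin_iff, mem_Iio]
  exact hL.eventually_nhds (P := fun v x => x < T v → P v x) hT <|
    (hL.lt (definableFunT_var none) hT.weaken).imp hP

theorem IsOMinimalOn.hasDerivAt (hL : IsOMinimalOn L) {g : ℝ → ℝ}
    (hg : DefinableT L {v : Fin 2 → ℝ | v 1 = g (v 0)}) {T A : (α → ℝ) → ℝ}
    (hT : DefinableFunT L T) (hA : DefinableFunT L A) :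
    DefinableT L {v | HasDerivAt g (A v) (T v)} := by
  simp only [hasDerivAt_iff_isLittleO, Asymptotics.isLittleO_iff, Real.norm_eq_abs, smul_eq_mul]
  refine DefinableT.forall (P := fun v c => 0 < c → ∀ᶠ x in 𝓝 (T v),
      |g x - g (T v) - (x - T v) * A v| ≤ c * |x - T v|) ?_
  refine (hL.lt (definableFunT_const 0) (definableFunT_var none)).imp <|
    hL.eventually_nhds hT.weaken ?_
  have hx := definableFunT_var (L := L) (none : Option (Option α))
  have hxT := hL.sub hx hT.weaken.weaken
  exact hL.le
    (hL.abs (hL.sub (hL.sub (hx.apply hg) (hT.weaken.weaken.apply hg))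
      (hL.mul hxT hA.weaken.weaken)))
    (hL.mul (definableFunT_var (some none)) (hL.abs hxT))

end Calculus

section RealFunctions

theorem monotoneOn_Ioo_of_eventually_le {g : ℝ → ℝ} {a b : ℝ}
    (hr : ∀ x ∈ Ioo a b, ∀ᶠ y in 𝓝[>] x, g x ≤ g y)
    (hl : ∀ x ∈ Ioo a b, ∀ᶠ y in 𝓝[<] x, g y ≤ g x) : MonotoneOn g (Ioo a b) := by
  intro x hx y hy hxy
  set T : Set ℝ := {c | c ∈ Icc x y ∧ g x ≤ g c}
  have hTb : BddAbove T := ⟨y, fun c hc => hc.1.2⟩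
  have hxT : x ∈ T := ⟨⟨le_rfl, hxy⟩, le_rfl⟩
  have hxs : x ≤ sSup T := le_csSup hTb hxT
  have hsy : sSup T ≤ y := csSup_le ⟨x, hxT⟩ fun c hc => hc.1.2
  have hs : sSup T ∈ Ioo a b := ⟨hx.1.trans_le hxs, hsy.trans_lt hy.2⟩
  have hgs : g x ≤ g (sSup T) := by
    obtain ⟨l, hls, hl'⟩ := mem_nhdsLT_iff_exists_Ioo_subset.1 (hl _ hs)
    obtain ⟨z, hz, hlz⟩ := exists_lt_of_lt_csSup ⟨x, hxT⟩ hls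
    rcases (le_csSup hTb hz).eq_or_lt with h | h
    · exact h ▸ hz.2
    · exact hz.2.trans (hl' ⟨hlz, h⟩)
  rcases hsy.eq_or_lt with h | h
  · exact h ▸ hgs
  · obtain ⟨z, hz, hzy⟩ := ((hr _ hs).and (Ioo_mem_nhdsGT h)).exists
    exact absurd (le_csSup hTb ⟨⟨hxs.trans hzy.1.le, hzy.2.le⟩, hgs.trans hz⟩) hzy.1.not_ge

theorem countable_setOf_strict_local_min (g : ℝ → ℝ) :
    {x | ∀ᶠ y in 𝓝[≠] x, g x < g y}.Countable := by
  have hsub : {x | ∀ᶠ y in 𝓝[≠] x, g x < g y} ⊆ ⋃ p : ℚ × ℚ,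
      {x | x ∈ Ioo (p.1 : ℝ) p.2 ∧ ∀ y ∈ Ioo (p.1 : ℝ) p.2, y ≠ x → g x < g y} := by
    intro x hx
    obtain ⟨a, b, hab, h⟩ := mem_nhds_iff_exists_Ioo_subset.1 (eventually_nhdsWithin_iff.1 hx)
    obtain ⟨p, hap, hpx⟩ := exists_rat_btwn hab.1
    obtain ⟨q, hxq, hqb⟩ := exists_rat_btwn hab.2
    exact mem_iUnion.2 ⟨(p, q), ⟨hpx, hxq⟩, fun y hy hyx =>
      h ⟨hap.trans hy.1, hy.2.trans hqb⟩ hyx⟩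
  refine (countable_iUnion fun p => Set.Subsingleton.countable ?_).mono hsub
  intro x hx y hy
  by_contra hne
  exact lt_asymm (hx.2 y hy.1 (Ne.symm hne)) (hy.2 x hx.1 hne)

theorem Convex.deriv_le_of_forall_deriv_le {g : ℝ → ℝ} {s : Set ℝ} {t c : ℝ} (hs : Convex ℝ s)
    (ht : t ∈ s) (hd : ∀ x ∈ s, DifferentiableAt ℝ g x) (hc : ∀ x ∈ interior s, deriv g x ≤ c)
    (hne : (𝓝[s \ {t}] t).NeBot) : deriv g t ≤ c := by
  have hmvt := hs.image_sub_le_mul_sub_of_deriv_le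
    (fun x hx => (hd x hx).continuousAt.continuousWithinAt)
    (fun x hx => (hd x (interior_subset hx)).differentiableWithinAt) hc
  refine le_of_tendsto ((hasDerivAt_iff_tendsto_slope.1 (hd t ht).hasDerivAt).mono_left
    (nhdsWithin_mono t (s := s \ {t}) inter_subset_right)) ?_
  filter_upwards [self_mem_nhdsWithin] with x hx
  rcases lt_or_gt_of_ne hx.2 with h | h
  · rw [slope_comm, slope_def_field, div_le_iff₀ (sub_pos.2 h)]
    exact hmvt x hx.1 t ht h.le
  · rw [slope_def_field, div_le_iff₀ (sub_pos.2 h)]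
    exact hmvt t ht x hx.1 h.le

end RealFunctions

section OMinimal

variable {L : FirstOrder.Language} [L.Structure ℝ]

theorem IsOMinimalOn.finite_diff_interior (hL : IsOMinimalOn L) {S : Set ℝ}
    (hS : DefinableT L {v : Fin 1 → ℝ | v 0 ∈ S}) : (S \ interior S).Finite := by
  obtain ⟨P, I, h⟩ := hL.finite_union S hS
  refine P.finite_toSet.subset fun x hx => ?_
  by_contra hxP
  have hxS := hx.1
  rw [h] at hxS
  obtain ⟨p, hp, hxp⟩ := mem_iUnion₂.1 (hxS.resolve_left hxP)
  refine hx.2 (mem_interior.2 ⟨_, ?_, isOpen_Ioo.preimage continuous_coe_real_ereal, hxp⟩)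
  intro y hy
  rw [h]
  exact Or.inr (mem_iUnion₂.2 ⟨p, hp, hy⟩)

theorem IsOMinimalOn.finite_of_countable (hL : IsOMinimalOn L) {S : Set ℝ}
    (hS : DefinableT L {v : Fin 1 → ℝ | v 0 ∈ S}) (hc : S.Countable) : S.Finite := by
  have h := hL.finite_diff_interior hS
  rwa [interior_eq_empty_iff_dense_compl.2 (hc.dense_compl ℝ), sdiff_empty] at h

theorem IsOMinimalOn.finite_frontier (hL : IsOMinimalOn L) {S : Set ℝ}
    (hS : DefinableT L {v : Fin 1 → ℝ | v 0 ∈ S}) : (frontier S).Finite := by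
  have hS' : DefinableT L {v : Fin 1 → ℝ | v 0 ∈ Sᶜ} := hS.not
  refine ((hL.finite_diff_interior hS).union (hL.finite_diff_interior hS')).subset fun x hx => ?_
  by_cases hxS : x ∈ S
  · exact Or.inl ⟨hxS, hx.2⟩
  · exact Or.inr ⟨hxS, fun h => (interior_compl (s := S) ▸ h) hx.1⟩

theorem IsPreconnected.subset_or_subset_compl_of_disjoint_frontier {X : Type*}
    [TopologicalSpace X] {s S : Set X} (hs : IsPreconnected s) (h : s ⊆ (frontier S)ᶜ) :
    s ⊆ S ∨ s ⊆ Sᶜ := by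
  refine (hs.subset_or_subset isOpen_interior isOpen_interior
    (disjoint_compl_right.mono interior_subset interior_subset) fun x hx => ?_).imp
    (fun h => h.trans interior_subset) fun h => h.trans interior_subset
  rw [interior_compl]
  by_contra hx'
  rw [mem_union, not_or, notMem_compl_iff] at hx'
  exact h hx ⟨hx'.2, hx'.1⟩

theorem Set.Finite.compl_mem_nhdsNE {X : Type*} [TopologicalSpace X] [T1Space X] {s : Set X}
    (hs : s.Finite) {t : X} : sᶜ ∈ 𝓝[≠] t := by
  refine mem_nhdsWithin.2 ⟨(s \ {t})ᶜ, hs.sdiff.isClosed.isOpen_compl, by simp, ?_⟩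
  exact fun x hx hxs => hx.1 ⟨hxs, hx.2⟩

theorem IsOMinimalOn.eventually_nhdsGT_or (hL : IsOMinimalOn L) {P : ℝ → Prop}
    (hP : DefinableT L {v : Fin 1 → ℝ | P (v 0)}) (t : ℝ) :
    (∀ᶠ x in 𝓝[>] t, P x) ∨ ∀ᶠ x in 𝓝[>] t, ¬ P x := by
  have hmem : (frontier {x | P x})ᶜ ∈ 𝓝[>] t :=
    nhdsWithin_mono t (fun x hx => ne_of_gt hx) (hL.finite_frontier hP).compl_mem_nhdsNE
  obtain ⟨u, hu, hsub⟩ := mem_nhdsGT_iff_exists_Ioo_subset.1 hmem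
  exact (isPreconnected_Ioo.subset_or_subset_compl_of_disjoint_frontier hsub).imp
    (mem_of_superset (Ioo_mem_nhdsGT hu)) (mem_of_superset (Ioo_mem_nhdsGT hu))

theorem IsOMinimalOn.eventually_nhdsLT_or (hL : IsOMinimalOn L) {P : ℝ → Prop}
    (hP : DefinableT L {v : Fin 1 → ℝ | P (v 0)}) (t : ℝ) :
    (∀ᶠ x in 𝓝[<] t, P x) ∨ ∀ᶠ x in 𝓝[<] t, ¬ P x := by
  have hmem : (frontier {x | P x})ᶜ ∈ 𝓝[<] t :=
    nhdsWithin_mono t (fun x hx => ne_of_lt hx) (hL.finite_frontier hP).compl_mem_nhdsNE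
  obtain ⟨u, hu, hsub⟩ := mem_nhdsLT_iff_exists_Ioo_subset.1 hmem
  exact (isPreconnected_Ioo.subset_or_subset_compl_of_disjoint_frontier hsub).imp
    (mem_of_superset (Ioo_mem_nhdsLT hu)) (mem_of_superset (Ioo_mem_nhdsLT hu))

theorem IsOMinimalOn.finite_not_differentiableAt_inter (hL : IsOMinimalOn L) {g : ℝ → ℝ}
    (hg : DefinableT L {v : Fin 2 → ℝ | v 1 = g (v 0)})
    (hN : DefinableT L {v : Fin 1 → ℝ | ¬ DifferentiableAt ℝ g (v 0)}) :
    {x | ¬ DifferentiableAt ℝ g x ∧ (∀ᶠ y in 𝓝[>] x, g x ≤ g y) ∧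
      ∀ᶠ y in 𝓝[<] x, g y ≤ g x}.Finite := by
  set S := {x | ¬ DifferentiableAt ℝ g x ∧ (∀ᶠ y in 𝓝[>] x, g x ≤ g y) ∧
    ∀ᶠ y in 𝓝[<] x, g y ≤ g x}
  have hvar : DefinableFunT L fun v : Fin 1 → ℝ => v 0 := definableFunT_var 0
  have hx := (definableFunT_var (L := L) (some (0 : Fin 1))).apply hg
  have hy := (definableFunT_var (L := L) (none : Option (Fin 1))).apply hg
  have hS : DefinableT L {v : Fin 1 → ℝ | v 0 ∈ S} :=
    hN.and ((hL.eventually_nhdsGT hvar (hL.le hx hy)).and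
      (hL.eventually_nhdsLT hvar (hL.le hy hx)))
  suffices h : interior S = ∅ by simpa [h] using hL.finite_diff_interior hS
  refine eq_empty_iff_forall_notMem.2 fun t ht => ?_
  obtain ⟨a, b, hab, hsub⟩ := mem_nhds_iff_exists_Ioo_subset.1 (mem_interior_iff_mem_nhds.1 ht)
  have hmono : MonotoneOn g (Ioo a b) := monotoneOn_Ioo_of_eventually_le
    (fun x hx => (hsub hx).2.1) fun x hx => (hsub hx).2.2
  have hae := hmono.ae_differentiableWithinAt_of_mem
  have hpos : MeasureTheory.volume (Ioo a b) ≠ 0 := by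
    simp [hab.1.trans hab.2]
  refine hpos (MeasureTheory.measure_eq_zero_iff_ae_notMem.2 (hae.mono fun x hd hx => ?_))
  exact (hsub hx).1 ((hd hx).differentiableAt (Ioo_mem_nhds hx.1 hx.2))

theorem IsOMinimalOn.differentiableAt (hL : IsOMinimalOn L) {g : ℝ → ℝ}
    (hg : DefinableT L {v : Fin 2 → ℝ | v 1 = g (v 0)}) {α : Type} {T : (α → ℝ) → ℝ}
    (hT : DefinableFunT L T) : DefinableT L {v | DifferentiableAt ℝ g (T v)} := by
  have h := DefinableT.exists (P := fun v a => HasDerivAt g a (T v))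
    (hL.hasDerivAt hg hT.weaken (definableFunT_var none))
  refine (congr_arg (DefinableT L) (Set.ext fun v => ?_)).mp h
  exact ⟨fun ⟨_, h⟩ => h.differentiableAt, fun h => ⟨_, h.hasDerivAt⟩⟩

theorem IsOMinimalOn.definable_deriv (hL : IsOMinimalOn L) {g : ℝ → ℝ}
    (hg : DefinableT L {v : Fin 2 → ℝ | v 1 = g (v 0)}) :
    DefinableT L {v : Fin 2 → ℝ | v 1 = deriv g (v 0)} := by
  have hT : DefinableFunT L fun v : Fin 2 → ℝ => v 0 := definableFunT_var 0
  have hA : DefinableFunT L fun v : Fin 2 → ℝ => v 1 := definableFunT_var 1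
  have h := (hL.hasDerivAt hg hT hA).or
    ((hL.differentiableAt hg hT).not.and (hA.eq (definableFunT_const 0)))
  refine (congr_arg (DefinableT L) (Set.ext fun v => ?_)).mp h
  by_cases hd : DifferentiableAt ℝ g (v 0)
  · exact ⟨fun h => h.elim (fun h => h.deriv.symm) fun h => absurd hd h.1,
      fun h => Or.inl (by rw [show v 1 = _ from h]; exact hd.hasDerivAt)⟩
  · simp only [mem_ofPred_eq, hd, deriv_zero_of_not_differentiableAt hd, not_false_eq_true,
      true_and, or_iff_right_iff_imp]
    exact fun h => absurd h.differentiableAt hd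

theorem IsOMinimalOn.finite_not_differentiableAt (hL : IsOMinimalOn L) {g : ℝ → ℝ}
    (hg : DefinableT L {v : Fin 2 → ℝ | v 1 = g (v 0)}) :
    {x | ¬ DifferentiableAt ℝ g x}.Finite := by
  have hN : DefinableT L {v : Fin 1 → ℝ | ¬ DifferentiableAt ℝ g (v 0)} :=
    (hL.differentiableAt hg (definableFunT_var 0)).not
  have hg' : DefinableT L {v : Fin 2 → ℝ | v 1 = (-g) (v 0)} :=
    (definableFunT_var 1).eq (hL.neg ((definableFunT_var 0).apply hg))
  have hN' : DefinableT L {v : Fin 1 → ℝ | ¬ DifferentiableAt ℝ (-g) (v 0)} :=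
    (hL.differentiableAt hg' (definableFunT_var 0)).not
  refine hL.finite_of_countable hN <|
    (((hL.finite_not_differentiableAt_inter hg hN).countable.union
      (hL.finite_not_differentiableAt_inter hg' hN').countable).union
      ((countable_setOf_strict_local_min g).union
        (countable_setOf_strict_local_min (-g)))).mono fun x hx => ?_
  have hx' : ¬ DifferentiableAt ℝ (-g) x := fun h => hx (neg_neg g ▸ h.neg)
  have hgy := (definableFunT_var (L := L) (0 : Fin 1)).apply hg
  have hle := hL.le (definableFunT_const (g x)) hgy
  have hge := hL.le hgy (definableFunT_const (g x))
  simp only [mem_union, mem_ofPred_eq, Pi.neg_apply, neg_le_neg_iff, neg_lt_neg_iff,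
    ← nhdsLT_sup_nhdsGT, eventually_sup]
  have r₁ := hL.eventually_nhdsGT_or (P := fun y => g x ≤ g y) hle x
  have r₂ := hL.eventually_nhdsGT_or (P := fun y => g y ≤ g x) hge x
  have l₁ := hL.eventually_nhdsLT_or (P := fun y => g x ≤ g y) hle x
  have l₂ := hL.eventually_nhdsLT_or (P := fun y => g y ≤ g x) hge x
  have weaken {l : Filter ℝ} {a b : ℝ → ℝ} (h : ∀ᶠ y in l, a y < b y) :
      ∀ᶠ y in l, a y ≤ b y := h.mono fun _ => le_of_lt
  simp only [not_le] at r₁ r₂ l₁ l₂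
  have r₃ := weaken (l := 𝓝[>] x) (a := g) (b := fun _ => g x)
  have l₃ := weaken (l := 𝓝[<] x) (a := fun _ => g x) (b := g)
  tauto

theorem IsOMinimalOn.eventually_lt_deriv (hL : IsOMinimalOn L) {g : ℝ → ℝ}
    (hg : DefinableT L {v : Fin 2 → ℝ | v 1 = g (v 0)}) {t c : ℝ}
    (hd : ∀ᶠ x in 𝓝 t, DifferentiableAt ℝ g x) (hc : c < deriv g t) :
    ∀ᶠ x in 𝓝 t, c < deriv g x := by
  have hdef := hL.lt (definableFunT_const c)
    ((definableFunT_var (0 : Fin 1)).apply (hL.definable_deriv hg))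
  obtain ⟨a, b, hab, hsub⟩ := mem_nhds_iff_exists_Ioo_subset.1 hd
  have hgt : ∀ᶠ x in 𝓝[>] t, c < deriv g x := by
    refine (hL.eventually_nhdsGT_or (P := fun x => c < deriv g x) hdef t).resolve_right fun h => ?_
    obtain ⟨u, hu, hu'⟩ := mem_nhdsGT_iff_exists_Ioo_subset.1 h
    have htu : t < min u b := lt_min hu hab.2
    refine hc.not_ge ((convex_Ico t (min u b)).deriv_le_of_forall_deriv_le (left_mem_Ico.2 htu)
      (fun x hx => hsub ⟨hab.1.trans_le hx.1, hx.2.trans_le (min_le_right _ _)⟩)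
      (fun x hx => ?_) ?_)
    · rw [interior_Ico] at hx
      exact not_lt.1 (hu' ⟨hx.1, hx.2.trans_le (min_le_left _ _)⟩)
    · rw [Ico_sdiff_left, nhdsWithin_Ioo_eq_nhdsGT htu]
      infer_instance
  have hlt : ∀ᶠ x in 𝓝[<] t, c < deriv g x := by
    refine (hL.eventually_nhdsLT_or (P := fun x => c < deriv g x) hdef t).resolve_right fun h => ?_
    obtain ⟨u, hu, hu'⟩ := mem_nhdsLT_iff_exists_Ioo_subset.1 h
    have htu : max u a < t := max_lt hu hab.1
    refine hc.not_ge ((convex_Ioc (max u a) t).deriv_le_of_forall_deriv_le (right_mem_Ioc.2 htu)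
      (fun x hx => hsub ⟨(le_max_right _ _).trans_lt hx.1, hx.2.trans_lt hab.2⟩)
      (fun x hx => ?_) ?_)
    · rw [interior_Ioc] at hx
      exact not_lt.1 (hu' ⟨(le_max_left _ _).trans_lt hx.1, hx.2⟩)
    · rw [Ioc_sdiff_right, nhdsWithin_Ioo_eq_nhdsLT htu]
      infer_instance
  have hne : ∀ᶠ x in 𝓝[≠] t, c < deriv g x :=
    nhdsLT_sup_nhdsGT t ▸ eventually_sup.2 ⟨hlt, hgt⟩
  filter_upwards [eventually_nhdsWithin_iff.1 hne] with x hx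
  by_cases h : x = t
  · rwa [h]
  · exact hx h

theorem IsOMinimalOn.continuousAt_deriv (hL : IsOMinimalOn L) {g : ℝ → ℝ}
    (hg : DefinableT L {v : Fin 2 → ℝ | v 1 = g (v 0)}) {t : ℝ}
    (hd : ∀ᶠ x in 𝓝 t, DifferentiableAt ℝ g x) : ContinuousAt (deriv g) t := by
  refine tendsto_order.2 ⟨fun c hc => hL.eventually_lt_deriv hg hd hc, fun c hc => ?_⟩
  have hg' : DefinableT L {v : Fin 2 → ℝ | v 1 = (-g) (v 0)} :=
    (definableFunT_var 1).eq (hL.neg ((definableFunT_var 0).apply hg))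
  have h := hL.eventually_lt_deriv hg' (hd.mono fun x hx => hx.neg) (c := -c)
    (by rw [deriv.neg]; exact neg_lt_neg hc)
  exact h.mono fun x hx => by rw [deriv.neg] at hx; exact neg_lt_neg_iff.1 hx

end OMinimal

/-- **Proposition 4 (Differentiability theorem).** For a definable function `f` with
definable domain `D ⊆ ℝ`, the derivative `f'` is definable on the set
`D' = {t : f is defined near t and differentiable at t}`, `D'` is open, `f'` is continuous
on `D'`, and `D \ D'` is finite. -/
theorem definable_derivative_theorem
    (L : FirstOrder.Language) [L.Structure ℝ] (hL : IsOMinimalOn L)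
    (f : ℝ → ℝ) (D : Set ℝ)
    (hDdef : DefinableT L {v : Fin 1 → ℝ | v 0 ∈ D})
    (hfdef : DefinableT L {v : Fin 2 → ℝ | v 0 ∈ D ∧ v 1 = f (v 0)})
    (D' : Set ℝ)
    (hD' : D' = {t | D ∈ 𝓝 t ∧ DifferentiableAt ℝ f t}) :
    DefinableT L {v : Fin 2 → ℝ | v 0 ∈ D' ∧ v 1 = deriv f (v 0)} ∧
    IsOpen D' ∧
    ContinuousOn (deriv f) D' ∧
    (D \ D').Finite := by
  classical
  set g : ℝ → ℝ := fun x => if x ∈ D then f x else 0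
  have hgdef : DefinableT L {v : Fin 2 → ℝ | v 1 = g (v 0)} := by
    have hD : DefinableT L {v : Fin 2 → ℝ | v 0 ∈ D} :=
      hDdef.comp₁ (P := fun x => x ∈ D) (definableFunT_var 0)
    have h := hfdef.or (hD.not.and ((definableFunT_var 1).eq (definableFunT_const 0)))
    refine (congr_arg (DefinableT L) (Set.ext fun v => ?_)).mp h
    by_cases hv : v 0 ∈ D <;> simp [g, hv]
  have hgf {t : ℝ} (ht : D ∈ 𝓝 t) : g =ᶠ[𝓝 t] f := mem_of_superset ht fun x hx => if_pos hx
  have hD'eq : D' = interior D \ {t | ¬ DifferentiableAt ℝ g t} := by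
    rw [hD']
    ext t
    simp only [mem_ofPred_eq, Set.mem_sdiff, not_not, mem_interior_iff_mem_nhds]
    exact and_congr_right fun ht => (hgf ht).differentiableAt_iff.symm
  have hfin := hL.finite_not_differentiableAt hgdef
  have hopen : IsOpen D' := by
    rw [hD'eq]
    exact isOpen_interior.sdiff hfin.isClosed
  have hderiv {t : ℝ} (ht : t ∈ D') : deriv f t = deriv g t := by
    rw [hD'] at ht
    exact (hgf ht.1).deriv_eq.symm
  refine ⟨?_, hopen, ?_, ?_⟩
  · have hT : DefinableFunT L fun v : Fin 2 → ℝ => v 0 := definableFunT_var 0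
    have h := ((hL.eventually_nhds (P := fun _ x => x ∈ D) hT
        (hDdef.comp₁ (P := fun x => x ∈ D) (definableFunT_var none))).and
      (hL.differentiableAt hgdef hT)).and
      ((definableFunT_var 1).eq (hT.apply (hL.definable_deriv hgdef)))
    refine (congr_arg (DefinableT L) (Set.ext fun v => ?_)).mp h
    have hv : v 0 ∈ D' ↔ (∀ᶠ x in 𝓝 (v 0), x ∈ D) ∧ DifferentiableAt ℝ g (v 0) := by
      rw [hD'eq, Set.mem_sdiff, mem_interior_iff_mem_nhds, mem_ofPred_eq, not_not]
      rfl
    simp only [mem_ofPred_eq, ← hv]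
    exact and_congr_right fun h => by rw [hderiv h]
  · refine ContinuousOn.congr (fun t ht => ?_) fun t ht => hderiv ht
    refine (hL.continuousAt_deriv hgdef ?_).continuousWithinAt
    filter_upwards [hopen.mem_nhds ht] with x hx
    rw [hD'eq] at hx
    exact not_not.1 hx.2
  · refine ((hL.finite_diff_interior hDdef).union hfin).subset fun t ht => ?_
    rw [hD'eq] at ht
    by_cases h : t ∈ interior D
    · exact Or.inr (not_not.1 fun h' => ht.2 ⟨h, h'⟩)
    · exact Or.inl ⟨ht.1, h⟩
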